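/- For all integers i and j one has in Ω_R/dR: \overline{t^{i} u\, d(t^{j})} = j Σ_{k=1}^{r} P_{i+j−1,−k}\, ω_k if i + j ≥ −r + 1, and \overline{t^{i} u\, d(t^{j})} = j Σ_{k=1}^{r} Q_{−i−j+1,−k}\, ω_k if i + j < −r + 1. -/

import Mathlib

open scoped BigOperators

noncomputable section

/-- The hyperelliptic ring `R = ℂ[t,t⁻¹,u : u² = p(t)]`, realized as
`ℂ[t,t⁻¹][X]/(X² - p)`. -/
abbrev HypRing (p : LaurentPolynomial ℂ) : Type :=
  AdjoinRoot (Polynomial.X ^ 2 - Polynomial.C p)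

/-- The element `t^i` of `R`, for `i : ℤ`. -/
noncomputable def tP (p : LaurentPolynomial ℂ) (i : ℤ) : HypRing p :=
  AdjoinRoot.of _ (LaurentPolynomial.T i)

/-- The element `u` of `R`. -/
noncomputable def uE (p : LaurentPolynomial ℂ) : HypRing p := AdjoinRoot.root _

/-- The module of Kähler differentials `Ω_R` of `R` over `ℂ`. -/
abbrev HypOmega (p : LaurentPolynomial ℂ) := KaehlerDifferential ℂ (HypRing p)

/-- The subspace `dR ⊆ Ω_R` of exact differentials. -/
noncomputable def dSub (p : LaurentPolynomial ℂ) : Submodule ℂ (HypOmega p) :=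
  LinearMap.range (KaehlerDifferential.D ℂ (HypRing p)).toLinearMap

/-- The quotient `Ω_R/dR`. -/
abbrev HypCenter (p : LaurentPolynomial ℂ) := HypOmega p ⧸ dSub p

/-- The class `\overline{f dg}` of `f dg` in `Ω_R/dR`. -/
noncomputable def cls (p : LaurentPolynomial ℂ) (f g : HypRing p) : HypCenter p :=
  Submodule.Quotient.mk (f • (KaehlerDifferential.D ℂ (HypRing p) g))

/-- `ω₀ = \overline{t⁻¹ dt}` and `ω_k = \overline{t^{-k} u dt}` for `k ≥ 1`. -/
noncomputable def om (p : LaurentPolynomial ℂ) (k : ℕ) : HypCenter p :=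
  if k = 0 then cls p (tP p (-1)) (tP p 1)
  else cls p (tP p (-(k : ℤ)) * uE p) (tP p 1)

lemma tP_add (p : LaurentPolynomial ℂ) (i j : ℤ) : tP p (i + j) = tP p i * tP p j := by
  simp only [tP, LaurentPolynomial.T_add, map_mul]

lemma tP_zero (p : LaurentPolynomial ℂ) : tP p 0 = 1 := by
  simp only [tP, LaurentPolynomial.T_zero, map_one]

lemma D_tP (p : LaurentPolynomial ℂ) (j : ℤ) :
    KaehlerDifferential.D ℂ (HypRing p) (tP p j)
      = (j : HypRing p) • tP p (j - 1) • KaehlerDifferential.D ℂ (HypRing p) (tP p 1) := by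
  have step (n : ℤ) : KaehlerDifferential.D ℂ (HypRing p) (tP p (n + 1))
      = tP p n • KaehlerDifferential.D ℂ (HypRing p) (tP p 1)
        + tP p 1 • KaehlerDifferential.D ℂ (HypRing p) (tP p n) := by
    rw [tP_add, Derivation.leibniz]
  induction j using Int.induction_on with
  | zero => simp [tP_zero]
  | succ n ih =>
    have h1 : tP p 1 * tP p ((n : ℤ) - 1) = tP p n := by rw [← tP_add]; congr 1; ring
    rw [step, ih, add_sub_cancel_right, ← h1]
    push_cast
    module
  | pred n ih =>
    have h1 : tP p (-1) * tP p 1 = 1 := by rw [← tP_add]; exact tP_zero p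
    have h2 : tP p (-1) * tP p (-(n : ℤ) - 1) = tP p (-(n : ℤ) - 1 - 1) := by
      rw [← tP_add]; congr 1; ring
    have h3 := step (-(n : ℤ) - 1)
    rw [sub_add_cancel, ih] at h3
    have h4 := congrArg (fun x => tP p (-1) • x) h3
    simp only [smul_add, ← mul_smul, h1, one_smul] at h4
    rw [← sub_eq_iff_eq_add'.mpr h4, ← h2]
    push_cast
    module

lemma cls_mul_uE_tP (p : LaurentPolynomial ℂ) (i j : ℤ) :
    cls p (tP p i * uE p) (tP p j) = (j : ℂ) • cls p (tP p (i + j - 1) * uE p) (tP p 1) := by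
  unfold cls
  rw [← Submodule.Quotient.mk_smul, D_tP, add_sub_assoc, tP_add, Int.cast_smul_eq_zsmul,
    Int.cast_smul_eq_zsmul]
  congr 1
  module

lemma mk_D_eq_zero (p : LaurentPolynomial ℂ) (x : HypRing p) :
    (Submodule.Quotient.mk (KaehlerDifferential.D ℂ (HypRing p) x) : HypCenter p) = 0 :=
  (Submodule.Quotient.mk_eq_zero _).mpr ⟨x, rfl⟩

lemma uE_sq (p : LaurentPolynomial ℂ) : uE p ^ 2 = AdjoinRoot.of _ p := by
  have h := AdjoinRoot.eval₂_root (Polynomial.X ^ 2 - Polynomial.C p)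
  rw [Polynomial.eval₂_sub, Polynomial.eval₂_pow, Polynomial.eval₂_X, Polynomial.eval₂_C,
    sub_eq_zero] at h
  exact h

lemma uE_sq_eq_sum {p : LaurentPolynomial ℂ} {s : Finset ℕ} {a : ℕ → ℂ}
    (hpa : p = ∑ i ∈ s, LaurentPolynomial.C (a i) * LaurentPolynomial.T (i : ℤ)) :
    uE p ^ 2 = ∑ i ∈ s, a i • tP p i := by
  rw [uE_sq]
  refine (congrArg (AdjoinRoot.of (Polynomial.X ^ 2 - Polynomial.C p)) hpa).trans ?_
  rw [map_sum]
  refine Finset.sum_congr rfl fun i _ => ?_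
  rw [map_mul, Algebra.smul_def]
  rfl

/-- The relation in `Ω_R/dR` coming from the exactness of `2 d(tⁿ u³)`. -/
lemma sum_smul_cls_eq_zero {p : LaurentPolynomial ℂ} {s : Finset ℕ} {a : ℕ → ℂ}
    (hpa : p = ∑ i ∈ s, LaurentPolynomial.C (a i) * LaurentPolynomial.T (i : ℤ)) (n : ℤ) :
    ∑ i ∈ s, (((3 * (i : ℤ) + 2 * n : ℤ) : ℂ) * a i) •
      cls p (tP p (n + i - 1) * uE p) (tP p 1) = 0 := by
  have hu := uE_sq_eq_sum hpa
  have hdu : (2 * uE p) • KaehlerDifferential.D ℂ (HypRing p) (uE p)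
      = ∑ i ∈ s, a i • (i : HypRing p) • tP p ((i : ℤ) - 1) •
          KaehlerDifferential.D ℂ (HypRing p) (tP p 1) := by
    have h := congrArg (KaehlerDifferential.D ℂ (HypRing p)) hu
    rw [map_sum, Derivation.leibniz_pow, Nat.add_one_sub_one, pow_one] at h
    rw [mul_smul, ofNat_smul_eq_nsmul, h]
    refine Finset.sum_congr rfl fun i _ => ?_
    rw [Derivation.map_smul, D_tP, Int.cast_natCast]
  have hD : KaehlerDifferential.D ℂ (HypRing p) (2 • (tP p n * uE p ^ 3))
      = (2 * (n : HypRing p) * tP p (n - 1) * uE p) • uE p ^ 2 •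
          KaehlerDifferential.D ℂ (HypRing p) (tP p 1)
        + (3 * tP p n * uE p) • (2 * uE p) •
          KaehlerDifferential.D ℂ (HypRing p) (uE p) := by
    rw [map_nsmul, Derivation.leibniz, Derivation.leibniz_pow, D_tP]
    module
  have hexact := mk_D_eq_zero p (2 • (tP p n * uE p ^ 3))
  rw [hD, hdu, hu, Finset.sum_smul, Finset.smul_sum, Finset.smul_sum,
    ← Finset.sum_add_distrib] at hexact
  rw [← hexact]
  simp only [cls, ← Submodule.Quotient.mk_smul]
  rw [← Submodule.mkQ_apply, map_sum]
  refine Finset.sum_congr rfl fun i _ => ?_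
  rw [Submodule.mkQ_apply]
  congr 1
  have h1 : tP p (n - 1) * tP p i = tP p (n + i - 1) := by rw [← tP_add]; congr 1; ring
  have h2 : tP p n * tP p ((i : ℤ) - 1) = tP p (n + i - 1) := by rw [← tP_add]; congr 1; ring
  rw [mul_comm _ (a i), mul_smul, Int.cast_smul_eq_zsmul, smul_assoc (a i) (tP p i),
    smul_comm _ (a i), smul_comm _ (a i), ← smul_add]
  congr 1
  simp only [← mul_smul, ← add_smul, ← Int.cast_smul_eq_zsmul (HypRing p)]
  congr 1
  push_cast
  linear_combination (-2 * (n : HypRing p) * uE p) * h1 - (3 * (i : HypRing p) * uE p) * h2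

lemma coeff_one_ne_zero_and_coeff_top_eq_one {r : ℕ} {α : Fin r → ℂ} (hα0 : ∀ i, α i ≠ 0) {a : ℕ → ℂ}
    (h : LaurentPolynomial.T 1 *
        ∏ i : Fin r, (LaurentPolynomial.T 1 - LaurentPolynomial.C (α i))
      = ∑ i ∈ Finset.Icc 1 (r + 1), LaurentPolynomial.C (a i) * LaurentPolynomial.T (i : ℤ)) :
    a 1 ≠ 0 ∧ a (r + 1) = 1 := by
  have hpoly : Polynomial.X * ∏ i : Fin r, (Polynomial.X - Polynomial.C (α i))
      = ∑ i ∈ Finset.Icc 1 (r + 1), Polynomial.C (a i) * Polynomial.X ^ i := by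
    apply Polynomial.toLaurent_injective
    simpa [map_prod, map_sum] using h
  have hcoeff (k : ℕ) (hk : k ≤ r) :
      (∏ i : Fin r, (Polynomial.X - Polynomial.C (α i))).coeff k = a (k + 1) := by
    rw [← Polynomial.coeff_X_mul, hpoly, Polynomial.finsetSum_coeff]
    simp [Polynomial.coeff_C_mul, Polynomial.coeff_X_pow, hk]
  constructor
  · rw [← zero_add 1, ← hcoeff 0 (Nat.zero_le r), Polynomial.coeff_zero_eq_eval_zero,
      Polynomial.eval_prod]
    simp [Finset.prod_ne_zero_iff, hα0]
  · rw [← hcoeff r le_rfl]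
    have hm := Polynomial.monic_prod_X_sub_C α Finset.univ
    have hd : (∏ i : Fin r, (Polynomial.X - Polynomial.C (α i))).natDegree = r := by
      simp
    simpa [Polynomial.Monic, Polynomial.leadingCoeff, hd] using hm

/-- If vectors satisfy the same linear recursion as their coefficient functions, and agree with
the combination at the earlier indices, they agree at the next one. -/
lemma eq_sum_smul_of_recursion {V ι κ : Type*} [AddCommGroup V] [Module ℂ V]
    {s : Finset ι} {S : Finset κ} {c : ℂ} (hc : c ≠ 0) {b : ι → ℂ} {v : V} {w : ι → V}
    {ω : κ → V} {F : κ → ℂ} {G : ι → κ → ℂ}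
    (hv : c • v = ∑ i ∈ s, b i • w i) (hF : ∀ k ∈ S, c * F k = ∑ i ∈ s, b i * G i k)
    (hw : ∀ i ∈ s, w i = ∑ k ∈ S, G i k • ω k) :
    v = ∑ k ∈ S, F k • ω k := by
  apply smul_right_injective V hc
  simp only
  rw [hv, Finset.smul_sum, Finset.sum_congr rfl fun i hi => by rw [hw i hi]]
  simp only [Finset.smul_sum, smul_smul]
  rw [Finset.sum_comm]
  refine Finset.sum_congr rfl fun k hk => ?_
  rw [hF k hk, Finset.sum_smul]

/-- For all integers `i` and `j` one has in `Ω_R/dR`: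
`\overline{t^i u d(t^j)} = j Σ_{k=1}^{r} P_{i+j−1,−k} ω_k` if `i + j ≥ −r + 1`, and
`\overline{t^i u d(t^j)} = j Σ_{k=1}^{r} Q_{−i−j+1,−k} ω_k` if `i + j < −r + 1`. -/
theorem odd_cocycles (r : ℕ) (hr : 1 ≤ r)
    (α : Fin r → ℂ) (hα0 : ∀ i, α i ≠ 0) (hαinj : Function.Injective α)
    (a : ℕ → ℂ) (p : LaurentPolynomial ℂ)
    (hp : p = LaurentPolynomial.T 1 *
      ∏ i : Fin r, (LaurentPolynomial.T 1 - LaurentPolynomial.C (α i)))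
    (hpa : p = ∑ i ∈ Finset.Icc 1 (r + 1),
      LaurentPolynomial.C (a i) * LaurentPolynomial.T (i : ℤ))
    (P : ℤ → ℤ → ℂ)
    (hPinit : ∀ l i : ℤ, -(r : ℤ) ≤ l → l ≤ -1 → -(r : ℤ) ≤ i → i ≤ -1 →
      P l i = if l = i then 1 else 0)
    (hPrec : ∀ k : ℤ, 0 ≤ k → ∀ i : ℤ,
      ((2 * k + (r : ℤ) + 3 : ℤ) : ℂ) * P k i
        = -∑ j ∈ Finset.Icc 1 r,
            ((3 * (j : ℤ) + 2 * k - 2 * (r : ℤ) : ℤ) : ℂ) * a j * P (k - r + j - 1) i)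
    (Q : ℤ → ℤ → ℂ)
    (hQinit : ∀ m i : ℤ, 1 ≤ m → m ≤ (r : ℤ) → -(r : ℤ) ≤ i → i ≤ -1 →
      Q m i = if m = -i then 1 else 0)
    (hQrec : ∀ m : ℤ, (r : ℤ) + 1 ≤ m → ∀ i : ℤ,
      ((2 * m - 3 : ℤ) : ℂ) * a 1 * Q m i
        = ∑ j ∈ Finset.Icc 2 (r + 1),
            ((3 * (j : ℤ) - 2 * m : ℤ) : ℂ) * a j * Q (m - j + 1) i) :
    ∀ i j : ℤ,
      (-(r : ℤ) + 1 ≤ i + j →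
        cls p (tP p i * uE p) (tP p j)
          = (j : ℂ) • ∑ k ∈ Finset.Icc 1 r, P (i + j - 1) (-(k : ℤ)) • om p k) ∧
      (i + j < -(r : ℤ) + 1 →
        cls p (tP p i * uE p) (tP p j)
          = (j : ℂ) • ∑ k ∈ Finset.Icc 1 r, Q (-i - j + 1) (-(k : ℤ)) • om p k) := by
  obtain ⟨ha1, har⟩ := coeff_one_ne_zero_and_coeff_top_eq_one hα0 (hp.symm.trans hpa)
  have hrel := sum_smul_cls_eq_zero hpa
  have hP (n : ℕ) : ∀ k : ℤ, -(r : ℤ) ≤ k → k < n - r →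
      cls p (tP p k * uE p) (tP p 1) = ∑ l ∈ Finset.Icc 1 r, P k (-(l : ℤ)) • om p l := by
    induction n with
    | zero => intro k h1 h2; push_cast at h2; omega
    | succ n ih =>
      intro k h1 h2
      rcases lt_or_ge k 0 with hk | hk
      · obtain ⟨m, rfl⟩ : ∃ m : ℕ, k = -(m : ℤ) := ⟨k.natAbs, by omega⟩
        rw [Finset.sum_eq_single_of_mem m (Finset.mem_Icc.mpr ⟨by omega, by omega⟩)]
        · rw [hPinit _ _ (by omega) (by omega) (by omega) (by omega), if_pos rfl, one_smul, om,
            if_neg (by omega)]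
        · intro l hl hlm
          rw [Finset.mem_Icc] at hl
          rw [hPinit _ _ (by omega) (by omega) (by omega) (by omega), if_neg (by omega), zero_smul]
      · refine eq_sum_smul_of_recursion (s := Finset.Icc 1 r)
          (c := ((2 * k + (r : ℤ) + 3 : ℤ) : ℂ))
          (b := fun j => -(((3 * (j : ℤ) + 2 * k - 2 * (r : ℤ) : ℤ) : ℂ) * a j))
          (w := fun j => cls p (tP p (k - r + j - 1) * uE p) (tP p 1))
          (G := fun j l => P (k - r + j - 1) (-(l : ℤ)))
          (Int.cast_ne_zero.mpr (by omega)) ?_ ?_ ?_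
        · have h := hrel (k - r)
          rw [Finset.sum_Icc_succ_top (by omega), har] at h
          have h3 : k - (r : ℤ) + ((r + 1 : ℕ) : ℤ) - 1 = k := by push_cast; ring
          have h4 : 3 * ((r + 1 : ℕ) : ℤ) + 2 * (k - r) = 2 * k + r + 3 := by push_cast; ring
          rw [h3, h4, mul_one, add_comm] at h
          rw [eq_neg_of_add_eq_zero_left h, ← Finset.sum_neg_distrib]
          refine Finset.sum_congr rfl fun j _ => ?_
          rw [neg_smul, show 3 * (j : ℤ) + 2 * (k - r) = 3 * j + 2 * k - 2 * r by ring]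
        · intro l _
          rw [hPrec k hk, ← Finset.sum_neg_distrib]
          exact Finset.sum_congr rfl fun j _ => (neg_mul _ _).symm
        · intro j hj
          rw [Finset.mem_Icc] at hj
          exact ih _ (by omega) (by push_cast at h2; omega)
  have hQ (n : ℕ) : ∀ m : ℤ, 1 ≤ m → m < n + 1 →
      cls p (tP p (-m) * uE p) (tP p 1) = ∑ l ∈ Finset.Icc 1 r, Q m (-(l : ℤ)) • om p l := by
    induction n with
    | zero => intro m h1 h2; push_cast at h2; omega
    | succ n ih =>
      intro m h1 h2
      rcases le_or_gt m r with hm | hm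
      · lift m to ℕ using by omega
        rw [Finset.sum_eq_single_of_mem m (Finset.mem_Icc.mpr ⟨by omega, by omega⟩)]
        · rw [hQinit _ _ (by omega) (by omega) (by omega) (by omega), if_pos (by omega), one_smul,
            om, if_neg (by omega)]
        · intro l hl hlm
          rw [Finset.mem_Icc] at hl
          rw [hQinit _ _ (by omega) (by omega) (by omega) (by omega), if_neg (by omega), zero_smul]
      · refine eq_sum_smul_of_recursion (s := Finset.Icc 2 (r + 1))
          (c := ((2 * m - 3 : ℤ) : ℂ) * a 1)
          (b := fun j => ((3 * (j : ℤ) - 2 * m : ℤ) : ℂ) * a j)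
          (w := fun j => cls p (tP p (-(m - j + 1)) * uE p) (tP p 1))
          (G := fun j l => Q (m - j + 1) (-(l : ℤ)))
          (mul_ne_zero (Int.cast_ne_zero.mpr (by omega)) ha1) ?_ ?_ ?_
        · have h := hrel (-m)
          rw [← Finset.add_sum_Ioc_eq_sum_Icc (by omega)] at h
          have h3 : -m + ((1 : ℕ) : ℤ) - 1 = -m := by push_cast; ring
          have h4 : 3 * ((1 : ℕ) : ℤ) + 2 * (-m) = -(2 * m - 3) := by push_cast; ring
          rw [h3, h4, Int.cast_neg, neg_mul, neg_smul, neg_add_eq_zero] at h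
          rw [h]
          refine Finset.sum_congr (by ext; simp; omega) fun j _ => ?_
          rw [show -m + (j : ℤ) - 1 = -(m - j + 1) by ring,
            show 3 * (j : ℤ) + 2 * (-m) = 3 * j - 2 * m by ring]
        · intro l _
          exact hQrec m (by omega) _
        · intro j hj
          rw [Finset.mem_Icc] at hj
          exact ih _ (by omega) (by push_cast at h2; omega)
  intro i j
  refine ⟨fun h => ?_, fun h => ?_⟩
  · rw [cls_mul_uE_tP, hP (i + j + r).toNat _ (by omega) (by omega)]
  · rw [cls_mul_uE_tP, show i + j - 1 = -(-i - j + 1) by ring,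
      hQ (-i - j + 1).toNat _ (by omega) (by omega)]

end
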